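/- In PG(5,2), there exist maximal partial line spreads of each of the sizes 13, 15, 16, 17, 18, 19 and 21 (the last being a spread). -/

import Mathlib

/-- A partial line spread of PG(n-1, q): a set of lines (2-dimensional linear
subspaces of `F^n`) that are pairwise skew, i.e. pairwise intersecting only
in the zero subspace. -/
def IsPartialLineSpread (F : Type*) [Field F] (n : ℕ)
    (S : Set (Submodule F (Fin n → F))) : Prop :=
  (∀ l ∈ S, Module.finrank F ↥l = 2) ∧
  (∀ l ∈ S, ∀ l' ∈ S, l ≠ l' → l ⊓ l' = ⊥)

/-- A maximal partial line spread: a partial line spread such that every line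
of the space meets some line of the spread nontrivially (equivalently, it
cannot be extended to a larger partial line spread). -/
def IsMaximalPartialLineSpread (F : Type*) [Field F] (n : ℕ)
    (S : Set (Submodule F (Fin n → F))) : Prop :=
  IsPartialLineSpread F n S ∧
  ∀ m : Submodule F (Fin n → F), Module.finrank F ↥m = 2 → ∃ l ∈ S, m ⊓ l ≠ ⊥

/-- The vector of `F^6` whose coordinates are the six lowest binary digits of `a`. -/
def bitVec (F : Type*) [Field F] (a : ℕ) : Fin 6 → F :=
  fun i => if a.testBit i then 1 else 0

/-- The line of PG(5,2) through the points with codes `p.1` and `p.2`. -/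
def bitLine (F : Type*) [Field F] (p : ℕ × ℕ) : Submodule F (Fin 6 → F) :=
  Submodule.span F {bitVec F p.1, bitVec F p.2}

/-- The codes of the three points on `bitLine F p`. -/
def linePoints (p : ℕ × ℕ) : List ℕ := [p.1, p.2, p.1 ^^^ p.2]

/-- The codes of the points of PG(5,2) lying on none of the lines in `L`. -/
def holes (L : List (ℕ × ℕ)) : List ℕ :=
  (List.range 64).filter fun x => x ≠ 0 ∧ x ∉ L.flatMap linePoints

/-- The lines in `L` are nondegenerate and pairwise disjoint, and the holes of `L` contain
no line. -/
def IsMaximalSpreadCode (L : List (ℕ × ℕ)) : Prop :=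
  (L.flatMap linePoints).Nodup ∧ (∀ x ∈ L.flatMap linePoints, x ≠ 0 ∧ x < 64) ∧
    ∀ a ∈ holes L, ∀ b ∈ holes L, a ≠ b → a ^^^ b ∉ holes L

instance : DecidablePred IsMaximalSpreadCode := fun L => by
  unfold IsMaximalSpreadCode; infer_instance

section BitVec

variable {F : Type*} [Field F]

lemma bitVec_zero : bitVec F 0 = 0 := by
  ext i; simp [bitVec]

lemma bitVec_inj {a b : ℕ} (ha : a < 64) (hb : b < 64) (h : bitVec F a = bitVec F b) :
    a = b := by
  refine Nat.eq_of_testBit_eq fun i => ?_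
  by_cases hi : i < 6
  · have h' := congrFun h ⟨i, hi⟩
    simp only [bitVec] at h'
    cases hA : a.testBit i <;> cases hB : b.testBit i <;> simp_all
  · have h64 : 64 ≤ 2 ^ i := Nat.pow_le_pow_right (n := 2) (by norm_num) (not_lt.mp hi)
    rw [Nat.testBit_lt_two_pow (ha.trans_le h64), Nat.testBit_lt_two_pow (hb.trans_le h64)]

lemma bitVec_ne_zero {a : ℕ} (ha : a < 64) (h0 : a ≠ 0) : bitVec F a ≠ 0 := fun h =>
  h0 (bitVec_inj ha (by norm_num) (h.trans bitVec_zero.symm))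

variable [Fintype F]

lemma eq_zero_or_eq_one_of_card_eq_two (hq : Fintype.card F = 2) (c : F) : c = 0 ∨ c = 1 := by
  classical
  have huniv : ({0, 1} : Finset F) = Finset.univ :=
    Finset.eq_univ_of_card _ (by rw [hq]; exact Finset.card_pair zero_ne_one)
  have hc : c ∈ ({0, 1} : Finset F) := huniv ▸ Finset.mem_univ c
  simpa using hc

lemma one_add_one_eq_zero_of_card_eq_two (hq : Fintype.card F = 2) : (1 + 1 : F) = 0 :=
  (eq_zero_or_eq_one_of_card_eq_two hq (1 + 1)).resolve_right (by simp)

lemma bitVec_xor (hq : Fintype.card F = 2) (a b : ℕ) :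
    bitVec F (a ^^^ b) = bitVec F a + bitVec F b := by
  ext i
  have h := one_add_one_eq_zero_of_card_eq_two hq
  simp only [bitVec, Nat.testBit_xor, Pi.add_apply]
  cases a.testBit i <;> cases b.testBit i <;> simp [h]

lemma exists_bitVec_eq (hq : Fintype.card F = 2) (x : Fin 6 → F) :
    ∃ a < 64, bitVec F a = x := by
  classical
  refine ⟨Nat.ofBits fun i => decide (x i = 1), Nat.ofBits_lt_two_pow _, ?_⟩
  ext i
  rcases eq_zero_or_eq_one_of_card_eq_two hq (x i) with h | h <;> simp [bitVec, h]

lemma mem_bitLine_iff (hq : Fintype.card F = 2) {p : ℕ × ℕ} {x : Fin 6 → F} :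
    x ∈ bitLine F p ↔ x = 0 ∨ ∃ a ∈ linePoints p, bitVec F a = x := by
  simp only [bitLine, Submodule.mem_span_pair, linePoints, List.mem_cons, List.not_mem_nil,
    or_false, exists_eq_or_imp, exists_eq_left, bitVec_xor hq]
  constructor
  · rintro ⟨c, d, rfl⟩
    rcases eq_zero_or_eq_one_of_card_eq_two hq c with rfl | rfl <;>
      rcases eq_zero_or_eq_one_of_card_eq_two hq d with rfl | rfl <;> simp
  · rintro (rfl | rfl | rfl | rfl)
    · exact ⟨0, 0, by simp⟩
    · exact ⟨1, 0, by simp⟩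
    · exact ⟨0, 1, by simp⟩
    · exact ⟨1, 1, by simp⟩

lemma finrank_bitLine (hq : Fintype.card F = 2) {p : ℕ × ℕ}
    (hp : ∀ x ∈ linePoints p, x ≠ 0 ∧ x < 64) :
    Module.finrank F (bitLine F p) = 2 := by
  have hne : ∀ x ∈ linePoints p, bitVec F x ≠ 0 := fun x hx =>
    bitVec_ne_zero (hp x hx).2 (hp x hx).1
  simp only [linePoints, List.mem_cons, List.not_mem_nil, or_false, forall_eq_or_imp,
    forall_eq, bitVec_xor hq] at hne
  have hli : LinearIndependent F ![bitVec F p.1, bitVec F p.2] := by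
    refine LinearIndependent.pair_iff.mpr fun c d h => ?_
    rcases eq_zero_or_eq_one_of_card_eq_two hq c with rfl | rfl <;>
      rcases eq_zero_or_eq_one_of_card_eq_two hq d with rfl | rfl <;> simp_all
  have h := finrank_span_eq_card hli
  rwa [Matrix.range_cons_cons_empty, Fintype.card_fin] at h

lemma bitLine_inf_bitLine_eq_bot (hq : Fintype.card F = 2) {p q : ℕ × ℕ}
    (hp : ∀ x ∈ linePoints p, x < 64) (hq' : ∀ x ∈ linePoints q, x < 64)
    (hpq : (linePoints p).Disjoint (linePoints q)) : bitLine F p ⊓ bitLine F q = ⊥ := by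
  refine (Submodule.eq_bot_iff _).mpr fun x ⟨hx, hx'⟩ => ?_
  rcases (mem_bitLine_iff hq).mp hx with h | ⟨a, ha, rfl⟩
  · exact h
  rcases (mem_bitLine_iff hq).mp hx' with h | ⟨b, hb, hab⟩
  · exact h
  obtain rfl := bitVec_inj (hq' b hb) (hp a ha) hab
  exact (hpq ha hb).elim

/-- A vector outside all the lines in `L` has its code among the holes. -/
lemma mem_holes (hq : Fintype.card F = 2) {L : List (ℕ × ℕ)} {a : ℕ} (ha : a < 64)
    (h0 : bitVec F a ≠ 0) (h : ∀ p ∈ L, bitVec F a ∉ bitLine F p) : a ∈ holes L := by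
  simp only [holes, List.mem_filter, List.mem_range, List.mem_flatMap, decide_eq_true_eq]
  refine ⟨ha, ?_, ?_⟩
  · rintro rfl
    exact h0 bitVec_zero
  · rintro ⟨p, hp, hap⟩
    exact h p hp ((mem_bitLine_iff hq).mpr (Or.inr ⟨a, hap, rfl⟩))

theorem exists_maximalPartialLineSpread (hq : Fintype.card F = 2) (L : List (ℕ × ℕ))
    (hL : IsMaximalSpreadCode L) :
    ∃ S : Set (Submodule F (Fin 6 → F)),
      IsMaximalPartialLineSpread F 6 S ∧ S.ncard = L.length := by
  classical
  obtain ⟨hnd, hpt, hmax⟩ := hL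
  have hdisj := (List.nodup_flatMap.mp hnd).2
  have hpt' : ∀ p ∈ L, ∀ x ∈ linePoints p, x ≠ 0 ∧ x < 64 := fun p hp x hx =>
    hpt x (List.mem_flatMap.mpr ⟨p, hp, hx⟩)
  have hrank : ∀ p ∈ L, Module.finrank F (bitLine F p) = 2 := fun p hp =>
    finrank_bitLine hq (hpt' p hp)
  have hinf : L.Pairwise fun p q => bitLine F p ⊓ bitLine F q = ⊥ :=
    hdisj.imp_of_mem fun hp hq' h => bitLine_inf_bitLine_eq_bot hq
      (fun x hx => (hpt' _ hp x hx).2) (fun x hx => (hpt' _ hq' x hx).2) h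
  have hnodup : (L.map (bitLine F)).Nodup := by
    refine List.pairwise_map.mpr (hinf.imp_of_mem fun {p q} hp _ h heq => ?_)
    have hr := hrank p hp
    rw [← heq, inf_idem] at h
    rw [h, finrank_bot] at hr
    omega
  refine ⟨{l | l ∈ L.map (bitLine F)}, ⟨⟨?_, ?_⟩, ?_⟩, ?_⟩
  · intro l hl
    obtain ⟨p, hp, rfl⟩ := List.mem_map.mp hl
    exact hrank p hp
  · intro l hl l' hl' hne
    obtain ⟨p, hp, rfl⟩ := List.mem_map.mp hl
    obtain ⟨q, hq', rfl⟩ := List.mem_map.mp hl'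
    have : Std.Symm fun p q => bitLine F p ⊓ bitLine F q = ⊥ :=
      ⟨fun _ _ h => by rwa [inf_comm]⟩
    exact hinf.forall hp hq' fun h => hne (h ▸ rfl)
  · intro m hm
    by_contra! hskew
    have hhole : ∀ a < 64, bitVec F a ∈ m → bitVec F a ≠ 0 → a ∈ holes L := by
      intro a ha ham h0
      refine mem_holes hq ha h0 fun p hp hap => h0 ?_
      have hbot := hskew _ (List.mem_map_of_mem (f := bitLine F) hp)
      exact (Submodule.eq_bot_iff _).mp hbot _ ⟨ham, hap⟩
    let B := Module.finBasisOfFinrankEq F m hm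
    have hB : LinearIndependent F ![(B 0 : Fin 6 → F), B 1] := by
      have h := B.linearIndependent.map' m.subtype m.ker_subtype
      rwa [show m.subtype ∘ B = ![(B 0 : Fin 6 → F), B 1] by
        ext i; fin_cases i <;> rfl] at h
    obtain ⟨a, ha, hxa⟩ := exists_bitVec_eq hq (B 0 : Fin 6 → F)
    obtain ⟨b, hb, hyb⟩ := exists_bitVec_eq hq (B 1 : Fin 6 → F)
    rw [← hxa, ← hyb] at hB
    have ham : bitVec F a ∈ m := hxa ▸ (B 0).2
    have hbm : bitVec F b ∈ m := hyb ▸ (B 1).2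
    have hpair := LinearIndependent.pair_iff.mp hB
    have ha0 : bitVec F a ≠ 0 := hB.ne_zero 0
    have hb0 : bitVec F b ≠ 0 := hB.ne_zero 1
    have hab0 : bitVec F (a ^^^ b) ≠ 0 := fun h => by
      rw [bitVec_xor hq] at h
      exact one_ne_zero (hpair 1 1 (by simpa using h)).1
    have hne : a ≠ b := by
      rintro rfl
      exact hab0 (by rw [Nat.xor_self, bitVec_zero])
    refine hmax a (hhole a ha ham ha0) b (hhole b hb hbm hb0) hne
      (hhole _ (Nat.xor_lt_two_pow (n := 6) ha hb) ?_ hab0)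
    rw [bitVec_xor hq]
    exact m.add_mem ham hbm
  · have h : {l | l ∈ L.map (bitLine F)} = ((L.map (bitLine F)).toFinset : Set _) := by
      ext; simp
    rw [h, Set.ncard_coe_finset, List.toFinset_card_of_nodup hnodup, List.length_map]

end BitVec

/-- In PG(5,2), there exist maximal partial line spreads of each of the sizes
13, 15, 16, 17, 18, 19 and 21. -/
theorem stmt10 (F : Type*) [Field F] [Fintype F] (hq : Fintype.card F = 2) :
    ∀ n ∈ ({13, 15, 16, 17, 18, 19, 21} : Set ℕ),
      ∃ S : Set (Submodule F (Fin 6 → F)),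
        IsMaximalPartialLineSpread F 6 S ∧ S.ncard = n := by
  rintro n (rfl | rfl | rfl | rfl | rfl | rfl | rfl)
  · exact exists_maximalPartialLineSpread hq
      [(1, 16), (2, 37), (3, 12), (8, 32), (13, 51), (14, 22), (20, 43), (21, 41),
       (23, 38), (25, 36), (26, 42), (27, 44), (29, 47)]
      (by decide +kernel)
  · exact exists_maximalPartialLineSpread hq
      [(1, 36), (2, 45), (4, 11), (6, 58), (9, 20), (13, 53), (14, 18), (16, 35),
       (17, 40), (19, 39), (22, 38), (23, 44), (25, 46), (27, 42), (31, 33)]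
      (by decide +kernel)
  · exact exists_maximalPartialLineSpread hq
      [(1, 16), (3, 44), (4, 49), (5, 18), (6, 24), (7, 51), (8, 20), (9, 54), (10, 34),
       (14, 39), (15, 55), (19, 33), (22, 38), (25, 37), (27, 32), (29, 35)]
      (by decide +kernel)
  · exact exists_maximalPartialLineSpread hq
      [(1, 6), (3, 48), (4, 33), (5, 41), (8, 49), (9, 20), (11, 32), (12, 21),
       (13, 23), (14, 16), (17, 36), (18, 46), (22, 45), (24, 47), (27, 35), (28, 40),
       (31, 34)]
      (by decide +kernel)
  · exact exists_maximalPartialLineSpread hq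
      [(1, 56), (2, 61), (3, 24), (4, 9), (5, 19), (6, 41), (8, 18), (10, 39), (11, 53),
       (12, 55), (14, 34), (16, 33), (17, 35), (21, 37), (25, 42), (28, 32), (30, 36),
       (31, 43)]
      (by decide +kernel)
  · exact exists_maximalPartialLineSpread hq
      [(1, 36), (2, 61), (3, 29), (4, 18), (5, 49), (6, 56), (7, 10), (8, 16), (9, 32),
       (11, 55), (12, 54), (14, 38), (15, 35), (19, 33), (20, 39), (23, 46), (25, 34),
       (26, 47), (27, 43)]
      (by decide +kernel)
  · exact exists_maximalPartialLineSpread hq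
      [(1, 30), (2, 49), (3, 61), (4, 19), (5, 24), (6, 57), (7, 42), (8, 33), (9, 50),
       (10, 34), (11, 16), (12, 39), (13, 35), (14, 18), (15, 55), (17, 36), (20, 32),
       (21, 37), (22, 44), (25, 47), (26, 38)]
      (by decide +kernel)
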